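/- Let I ⊆ S be a squarefree monomial ideal with minimal primary decomposition I = I_{α_1} ∩ ⋯ ∩ I_{α_r} satisfying I_{α_1} + ⋯ + I_{α_r} = (x_1,…,x_n). Fix e ≥ 0 and q = p^e. Then J_q ≠ 0 — i.e., (I^{[q]} :_S I) ≠ I^{[q]} + ((x^1)^{q-1}) — if and only if there exists a minimal monomial generator x^γ of (I^{[q]} :_S I) having γ_i = q, γ_j = q−1 and γ_k = 0 for some indices 1 ≤ i, j, k ≤ n. -/

import Mathlib

noncomputable section

/-- The `q`-th Frobenius power of an ideal: the ideal generated by `{f^q : f ∈ I}`. -/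
def frobPow {R : Type*} [CommRing R] (q : ℕ) (I : Ideal R) : Ideal R :=
  Ideal.span ((fun f => f ^ q) '' (I : Set R))

/-- The monomial `x^γ = x_1^{γ_1} ⋯ x_n^{γ_n}` in `k[[x_1,…,x_n]]`. -/
def mon (k : Type*) [Field k] {n : ℕ} (γ : Fin n → ℕ) : MvPowerSeries (Fin n) k :=
  ∏ i, (MvPowerSeries.X i : MvPowerSeries (Fin n) k) ^ γ i

/-- The face ideal `I_α`, generated by the variables `x_i` with `α i = 1`. -/
def faceIdeal (k : Type*) [Field k] {n : ℕ} (α : Fin n → ℕ) :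
    Ideal (MvPowerSeries (Fin n) k) :=
  Ideal.span {f | ∃ i, α i = 1 ∧ f = MvPowerSeries.X i}

/-- `I = I_{α_1} ∩ ⋯ ∩ I_{α_r}` is the minimal primary decomposition of the squarefree
monomial ideal `I` into face ideals: each `α j` is a nonzero `{0,1}`-vector, `I` is the
intersection of the face ideals `I_{α j}`, and the decomposition is irredundant (the
supports of the `α j` are pairwise incomparable). -/
def IsMinFaceDecomp (k : Type*) [Field k] {n r : ℕ} (α : Fin r → Fin n → ℕ)
    (I : Ideal (MvPowerSeries (Fin n) k)) : Prop :=
  (∀ j i, α j i = 0 ∨ α j i = 1) ∧ (∀ j, α j ≠ 0) ∧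
    I = ⨅ j, faceIdeal k (α j) ∧
    ∀ j l, j ≠ l → ¬ ({i | α j i = 1} ⊆ {i | α l i = 1})

/-- `x^γ` is a minimal monomial generator of the monomial ideal `J`: `x^γ ∈ J` and no
monomial properly dividing `x^γ` belongs to `J`. -/
def IsMinGen (k : Type*) [Field k] {n : ℕ} (J : Ideal (MvPowerSeries (Fin n) k))
    (γ : Fin n → ℕ) : Prop :=
  mon k γ ∈ J ∧ ∀ δ : Fin n → ℕ, (∀ i, δ i ≤ γ i) → δ ≠ γ → mon k δ ∉ J

/-- `J_q`: the unique minimal monomial ideal with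
`(I^{[q]} :_S I) = I^{[q]} + J_q + ((x_1⋯x_n)^{q-1})`; equivalently, the ideal generated by
those minimal monomial generators of `(I^{[q]} :_S I)` lying neither in `I^{[q]}` nor in
the principal ideal `((x_1⋯x_n)^{q-1})`. -/
def Jideal (k : Type*) [Field k] {n : ℕ} (q : ℕ) (I : Ideal (MvPowerSeries (Fin n) k)) :
    Ideal (MvPowerSeries (Fin n) k) :=
  Ideal.span (mon k '' {γ | IsMinGen k ((frobPow q I).colon I) γ ∧
    mon k γ ∉ frobPow q I ∧ mon k γ ∉ Ideal.span {mon k (fun _ => 1) ^ (q - 1)}})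

section MonomialIdeal

variable {k : Type*} [Field k] {n : ℕ}

theorem mon_eq_monomial (γ : Fin n → ℕ) :
    mon k γ = MvPowerSeries.monomial (Finsupp.equivFunOnFinite.symm γ) 1 := by
  rw [MvPowerSeries.monomial_eq', map_one, one_mul, mon,
    Finsupp.prod_fintype _ _ fun i => pow_zero _]
  rfl

theorem coeff_mon_ne_zero {γ : Fin n → ℕ} {d : Fin n →₀ ℕ} :
    MvPowerSeries.coeff d (mon k γ) ≠ 0 ↔ (d : Fin n → ℕ) = γ := by
  classical
  rw [mon_eq_monomial, MvPowerSeries.coeff_monomial]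
  simp only [ne_eq, ite_eq_right_iff, one_ne_zero, imp_false, not_not]
  constructor
  · rintro rfl
    rfl
  · intro h
    ext i
    simp [← h]

theorem coeff_add_mul_mon (f : MvPowerSeries (Fin n) k) (d : Fin n →₀ ℕ) (γ : Fin n → ℕ) :
    MvPowerSeries.coeff (d + Finsupp.equivFunOnFinite.symm γ) (f * mon k γ) =
      MvPowerSeries.coeff d f := by
  rw [mon_eq_monomial, MvPowerSeries.coeff_add_mul_monomial, mul_one]

theorem mon_mul_mon (γ δ : Fin n → ℕ) : mon k γ * mon k δ = mon k (γ + δ) := by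
  simp [mon, pow_add, Finset.prod_mul_distrib]

theorem mon_pow (γ : Fin n → ℕ) (m : ℕ) : mon k γ ^ m = mon k (fun i => γ i * m) := by
  simp [mon, pow_mul, Finset.prod_pow]

theorem mon_single (i : Fin n) : mon k (Pi.single i 1) = MvPowerSeries.X i := by
  rw [mon, Finset.prod_eq_single i] <;> simp +contextual

theorem mon_ne_zero (γ : Fin n → ℕ) : mon k γ ≠ 0 := by
  intro h
  have := (coeff_mon_ne_zero (k := k) (d := Finsupp.equivFunOnFinite.symm γ)).2 rfl
  simp [h] at this

/-- A power series whose monomials are all divisible by one of finitely many given monomials lies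
in the ideal they generate. -/
theorem mem_span_mon_of_finset (F : Finset (Fin n → ℕ)) (f : MvPowerSeries (Fin n) k)
    (hf : ∀ d, MvPowerSeries.coeff d f ≠ 0 → ∃ t ∈ F, t ≤ (d : Fin n → ℕ)) :
    f ∈ Ideal.span (mon k '' (F : Set (Fin n → ℕ))) := by
  classical
  induction F using Finset.induction_on generalizing f with
  | empty =>
    have : f = 0 := by
      ext d
      by_contra h
      simpa using hf d h
    simp [this]
  | insert t F ht ih =>
    let e : Fin n →₀ ℕ := Finsupp.equivFunOnFinite.symm t
    let g : MvPowerSeries (Fin n) k := fun d => MvPowerSeries.coeff (d + e) f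
    have hg : ∀ d, MvPowerSeries.coeff d (g * mon k t) =
        if e ≤ d then MvPowerSeries.coeff d f else 0 := by
      intro d
      rw [mon_eq_monomial, MvPowerSeries.coeff_mul_monomial, mul_one]
      split_ifs with h
      · change MvPowerSeries.coeff (d - e + e) f = _
        rw [tsub_add_cancel_of_le h]
      · rfl
    have hrest : f - g * mon k t ∈ Ideal.span (mon k '' (F : Set (Fin n → ℕ))) := by
      refine ih _ fun d hd => ?_
      rw [map_sub, hg] at hd
      split_ifs at hd with h
      · simp at hd
      · obtain ⟨u, hu, hud⟩ := hf d (by simpa using hd)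
        rcases Finset.mem_insert.1 hu with rfl | hu
        · exact absurd hud h
        · exact ⟨u, hu, hud⟩
    rw [← sub_add_cancel f (g * mon k t)]
    refine add_mem (Ideal.span_mono (Set.image_mono (by simp)) hrest) ?_
    exact Ideal.mul_mem_left _ _ (Ideal.subset_span ⟨t, by simp, rfl⟩)

/-- Membership in a monomial ideal of `k[[x_1,…,x_n]]` is decided monomial by monomial. -/
theorem mem_span_mon_iff (T : Set (Fin n → ℕ)) (f : MvPowerSeries (Fin n) k) :
    f ∈ Ideal.span (mon k '' T) ↔
      ∀ d, MvPowerSeries.coeff d f ≠ 0 → ∃ t ∈ T, t ≤ (d : Fin n → ℕ) := by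
  classical
  constructor
  · intro hf
    induction hf using Submodule.span_induction with
    | mem x hx =>
      obtain ⟨t, ht, rfl⟩ := hx
      intro d hd
      exact ⟨t, ht, (coeff_mon_ne_zero.1 hd).ge⟩
    | zero => simp
    | add x y _ _ hx hy =>
      intro d hd
      by_cases h : MvPowerSeries.coeff d x = 0
      · exact hy d (by simpa [h] using hd)
      · exact hx d h
    | smul a x _ hx =>
      intro d hd
      rw [smul_eq_mul, MvPowerSeries.coeff_mul] at hd
      obtain ⟨⟨u, v⟩, huv, h⟩ := Finset.exists_ne_zero_of_sum_ne_zero hd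
      obtain ⟨t, ht, htv⟩ := hx v (right_ne_zero_of_mul h)
      refine ⟨t, ht, fun i => (htv i).trans ?_⟩
      rw [← Finset.HasAntidiagonal.mem_antidiagonal.1 huv]
      simp
  · intro hf
    have hfin : {t | Minimal (· ∈ T) t}.Finite :=
      WellQuasiOrderedLE.finite_of_isAntichain (setOfPred_minimal_antichain _)
    refine Ideal.span_mono (Set.image_mono fun t ht => ?_)
      (mem_span_mon_of_finset hfin.toFinset f fun d hd => ?_)
    · exact (hfin.mem_toFinset.1 ht).1
    · obtain ⟨t, ht, htd⟩ := hf d hd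
      obtain ⟨u, hut, hu⟩ := exists_minimal_le_of_wellFoundedLT (· ∈ T) t ht
      exact ⟨u, hfin.mem_toFinset.2 hu, hut.trans htd⟩

theorem mem_span_mon_iff_of_isUpperSet {T : Set (Fin n → ℕ)} (hT : IsUpperSet T)
    (f : MvPowerSeries (Fin n) k) :
    f ∈ Ideal.span (mon k '' T) ↔ ∀ d, MvPowerSeries.coeff d f ≠ 0 → (d : Fin n → ℕ) ∈ T := by
  rw [mem_span_mon_iff]
  exact forall₂_congr fun d _ =>
    ⟨fun ⟨t, ht, htd⟩ => hT htd ht, fun h => ⟨_, h, le_rfl⟩⟩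

theorem mon_mem_span_mon_iff {T : Set (Fin n → ℕ)} (hT : IsUpperSet T) (γ : Fin n → ℕ) :
    mon k γ ∈ Ideal.span (mon k '' T) ↔ γ ∈ T := by
  rw [mem_span_mon_iff_of_isUpperSet hT]
  constructor
  · intro h
    exact h (Finsupp.equivFunOnFinite.symm γ) (coeff_mon_ne_zero.2 rfl)
  · intro h d hd
    rwa [coeff_mon_ne_zero.1 hd]

theorem isMinGen_span_mon_iff {T : Set (Fin n → ℕ)} (hT : IsUpperSet T) (γ : Fin n → ℕ) :
    IsMinGen k (Ideal.span (mon k '' T)) γ ↔ Minimal (· ∈ T) γ := by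
  simp only [IsMinGen, mon_mem_span_mon_iff hT]
  refine and_congr_right fun _ => ?_
  constructor
  · intro h δ hδ hle
    by_contra hne
    exact h δ hle (fun heq => hne heq.ge) hδ
  · intro h δ hle hne hδ
    exact hne (le_antisymm hle (h hδ hle))

end MonomialIdeal

section Combinatorics

variable {n r : ℕ}

/-- The exponents of the monomials in `⨅ j, (x_i ^ q : α j i = 1)`. -/
def hitExps (α : Fin r → Fin n → ℕ) (q : ℕ) : Set (Fin n → ℕ) :=
  {γ | ∀ j, ∃ i, α j i = 1 ∧ q ≤ γ i}

/-- The exponents of the monomials in `⨅ j, ((x_i ^ q : α j i = 1) + (x^{α j})^{q-1})`. -/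
def colonExps (α : Fin r → Fin n → ℕ) (q : ℕ) : Set (Fin n → ℕ) :=
  {γ | ∀ j, (∃ i, α j i = 1 ∧ q ≤ γ i) ∨ ∀ i, α j i = 1 → q - 1 ≤ γ i}

theorem isUpperSet_hitExps (α : Fin r → Fin n → ℕ) (q : ℕ) : IsUpperSet (hitExps α q) := by
  intro γ δ h hγ j
  obtain ⟨i, hi, hq⟩ := hγ j
  exact ⟨i, hi, hq.trans (h i)⟩

theorem isUpperSet_colonExps (α : Fin r → Fin n → ℕ) (q : ℕ) : IsUpperSet (colonExps α q) := by
  intro γ δ h hγ j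
  rcases hγ j with ⟨i, hi, hq⟩ | hall
  · exact Or.inl ⟨i, hi, hq.trans (h i)⟩
  · exact Or.inr fun i hi => (hall i hi).trans (h i)

theorem hitExps_subset_colonExps (α : Fin r → Fin n → ℕ) (q : ℕ) :
    hitExps α q ⊆ colonExps α q := fun _ h j => Or.inl (h j)

theorem Ici_subset_colonExps (α : Fin r → Fin n → ℕ) (q : ℕ) :
    Set.Ici (fun _ => q - 1) ⊆ colonExps α q := fun _ h _ => Or.inr fun i _ => h i

theorem add_mem_hitExps {α : Fin r → Fin n → ℕ} {q : ℕ} {γ β : Fin n → ℕ}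
    (hγ : γ ∈ colonExps α q) (hβ : β ∈ hitExps α 1) : γ + β ∈ hitExps α q := by
  intro j
  rcases hγ j with ⟨i, hi, hq⟩ | hall
  · exact ⟨i, hi, by simp only [Pi.add_apply]; omega⟩
  · obtain ⟨i, hi, h1⟩ := hβ j
    have := hall i hi
    exact ⟨i, hi, by simp only [Pi.add_apply]; omega⟩

theorem mem_colonExps_of_forall_add_mem {α : Fin r → Fin n → ℕ} {q : ℕ}
    (hinc : ∀ j l, j ≠ l → ¬ ({i | α j i = 1} ⊆ {i | α l i = 1})) {γ : Fin n → ℕ}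
    (hγ : ∀ β ∈ hitExps α 1, γ + β ∈ hitExps α q) : γ ∈ colonExps α q := by
  classical
  intro j
  by_contra! hcon
  obtain ⟨hlt, i₀, hi₀, hsmall⟩ := hcon
  let β : Fin n → ℕ := fun i => if i = i₀ ∨ α j i ≠ 1 then 1 else 0
  have hβ : β ∈ hitExps α 1 := by
    intro l
    by_cases hjl : l = j
    · subst hjl
      exact ⟨i₀, hi₀, by simp [β]⟩
    · obtain ⟨i, hi, hij⟩ := Set.not_subset.1 (hinc l j hjl)
      have hij : α j i ≠ 1 := hij
      exact ⟨i, hi, by simp [β, hij]⟩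
  obtain ⟨i, hi, hq⟩ := hγ β hβ j
  have := hlt i hi
  by_cases h : i = i₀
  · subst h
    simp [β] at hq
    omega
  · simp [β, h, hi] at hq
    omega

theorem Minimal.update_notMem {T : Set (Fin n → ℕ)} {γ : Fin n → ℕ}
    (hγ : Minimal (· ∈ T) γ) {i : Fin n} {v : ℕ} (hv : v < γ i) :
    Function.update γ i v ∉ T := by
  intro hmem
  have h := hγ.2 hmem (update_le_self_iff.2 hv.le) i
  simp only [Function.update_self] at h
  omega

/-- A minimal element of `colonExps α q` that is neither in `hitExps α q` nor above `(q-1,…,q-1)`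
is one having entries `q`, `q - 1` and `0`. -/
theorem minimal_colonExps_iff {α : Fin r → Fin n → ℕ} {q : ℕ} (hq : 1 ≤ q)
    (hne : ∀ j, ∃ i, α j i = 1) (hcov : ∀ i, ∃ j, α j i = 1) {γ : Fin n → ℕ}
    (hγ : Minimal (· ∈ colonExps α q) γ) :
    (γ ∉ hitExps α q ∧ γ ∉ Set.Ici (fun _ => q - 1)) ↔
      (∃ i, γ i = q) ∧ (∃ j, γ j = q - 1) ∧ ∃ l, γ l = 0 := by
  constructor
  · rintro ⟨hhit, hIci⟩
    have hmem : γ ∈ colonExps α q := hγ.1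
    obtain ⟨l, hl⟩ : ∃ l, γ l < q - 1 := by
      by_contra! h
      exact hIci h
    refine ⟨?_, ?_, l, ?_⟩
    · obtain ⟨m, hm⟩ := hcov l
      obtain ⟨i, hi, hqi⟩ := (hmem m).resolve_right fun h => by have := h l hm; omega
      refine ⟨i, hqi.antisymm' (not_lt.1 fun hlt => hγ.update_notMem hlt fun j => ?_)⟩
      rcases hmem j with ⟨a, ha, hqa⟩ | hall
      · refine Or.inl ⟨a, ha, ?_⟩
        by_cases hai : a = i <;> simp [hai, hqa]
      · refine Or.inr fun a ha => ?_
        have := hall a ha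
        by_cases hai : a = i
        · simp [hai]
        · simpa [hai] using this
    · obtain ⟨j, hj⟩ : ∃ j, ∀ i, α j i = 1 → γ i < q := by
        by_contra! h
        exact hhit h
      obtain ⟨i, hi⟩ := hne j
      have hall := (hmem j).resolve_left fun ⟨a, ha, hqa⟩ => (hj a ha).not_ge hqa
      have := hall i hi
      have := hj i hi
      exact ⟨i, by omega⟩
    · by_contra hl0
      refine hγ.update_notMem (Nat.pos_of_ne_zero hl0) fun j => ?_
      rcases hmem j with ⟨a, ha, hqa⟩ | hall
      · have hal : a ≠ l := by rintro rfl; omega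
        exact Or.inl ⟨a, ha, by simpa [hal] using hqa⟩
      · refine Or.inr fun a ha => ?_
        have := hall a ha
        have hal : a ≠ l := by rintro rfl; omega
        simpa [hal] using this
  · rintro ⟨⟨i, hi⟩, ⟨j, hj⟩, l, hl⟩
    have hq2 : 2 ≤ q := by
      by_contra hlt
      obtain rfl : q = 1 := by omega
      have h0 : (0 : Fin n → ℕ) ∈ colonExps α 1 := fun j => Or.inr fun i _ => Nat.zero_le _
      have := hγ.2 h0 (fun i => Nat.zero_le _) i
      simp only [Pi.zero_apply] at this
      omega
    refine ⟨fun hhit => ?_, fun hIci => ?_⟩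
    · refine hγ.update_notMem (i := j) (v := 0) (by omega) fun m => ?_
      obtain ⟨a, ha, hqa⟩ := hhit m
      have haj : a ≠ j := by rintro rfl; omega
      exact Or.inl ⟨a, ha, by simpa [haj] using hqa⟩
    · have : q - 1 ≤ γ l := hIci l
      omega

end Combinatorics

section FaceIdeals

variable {k : Type*} [Field k] {n r : ℕ}

theorem faceIdeal_eq_span_mon (α : Fin n → ℕ) :
    faceIdeal k α = Ideal.span (mon k '' ((fun i => Pi.single i 1) '' {i | α i = 1})) := by
  rw [faceIdeal, Set.image_image]
  congr 1
  ext f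
  simp [mon_single, eq_comm]

theorem single_one_le_iff {i : Fin n} {d : Fin n → ℕ} : Pi.single i 1 ≤ d ↔ 1 ≤ d i := by
  classical
  constructor
  · intro h
    simpa using h i
  · intro h j
    by_cases hj : j = i
    · subst hj
      simpa using h
    · simp [hj]

theorem iInf_faceIdeal_eq_span_mon (α : Fin r → Fin n → ℕ) :
    ⨅ j, faceIdeal k (α j) = Ideal.span (mon k '' hitExps α 1) := by
  ext f
  rw [mem_span_mon_iff_of_isUpperSet (isUpperSet_hitExps α 1), Ideal.mem_iInf]
  simp only [faceIdeal_eq_span_mon, mem_span_mon_iff, Set.exists_mem_image, single_one_le_iff]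
  exact ⟨fun h d hd j => h j d hd, fun h j d hd => h d hd j⟩

theorem exists_eq_one_of_iSup_faceIdeal (α : Fin r → Fin n → ℕ)
    (hsum : (⨆ j, faceIdeal k (α j)) =
      Ideal.span (Set.range (MvPowerSeries.X : Fin n → MvPowerSeries (Fin n) k)))
    (i : Fin n) : ∃ j, α j i = 1 := by
  have hX : mon k (Pi.single i 1) ∈ ⨆ j, faceIdeal k (α j) := by
    rw [hsum, mon_single]
    exact Ideal.subset_span ⟨i, rfl⟩
  have hle : ⨆ j, faceIdeal k (α j) ≤
      Ideal.span (mon k '' ((fun i => Pi.single i 1) '' {i | ∃ j, α j i = 1})) := by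
    refine iSup_le fun j => ?_
    rw [faceIdeal_eq_span_mon]
    exact Ideal.span_mono (Set.image_mono (Set.image_mono fun i hi => ⟨j, hi⟩))
  obtain ⟨_, ⟨l, hl, rfl⟩, hle⟩ := (mem_span_mon_iff _ _).1 (hle hX)
    (Finsupp.equivFunOnFinite.symm (Pi.single i 1)) (coeff_mon_ne_zero.2 rfl)
  have h : l = i := by
    by_contra h
    have := hle l
    simp [h] at this
  exact h ▸ hl

theorem frobPow_span_mon_hitExps (p : ℕ) [Fact p.Prime] [CharP k p] (α : Fin r → Fin n → ℕ)
    (e : ℕ) :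
    frobPow (p ^ e) (Ideal.span (mon k '' hitExps α 1)) =
      Ideal.span (mon k '' hitExps α (p ^ e)) := by
  classical
  have : CharP (MvPowerSeries (Fin n) k) p :=
    charP_of_injective_ringHom (MvPowerSeries.C_injective) p
  have hq : 0 < p ^ e := pow_pos (Fact.out : p.Prime).pos e
  apply le_antisymm
  · refine Ideal.span_le.2 ?_
    rintro _ ⟨f, hf, rfl⟩
    change f ^ p ^ e ∈ Ideal.span (mon k '' hitExps α (p ^ e))
    induction hf using Submodule.span_induction with
    | mem x hx =>
      obtain ⟨β, hβ, rfl⟩ := hx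
      rw [mon_pow]
      refine Ideal.subset_span ⟨_, fun j => ?_, rfl⟩
      obtain ⟨i, hi, h1⟩ := hβ j
      exact ⟨i, hi, Nat.le_mul_of_pos_left _ h1⟩
    | zero =>
      rw [zero_pow hq.ne']
      exact zero_mem _
    | add x y _ _ hx hy =>
      rw [add_pow_char_pow]
      exact add_mem hx hy
    | smul a x _ hx =>
      rw [smul_eq_mul, mul_pow]
      exact Ideal.mul_mem_left _ _ hx
  · refine Ideal.span_le.2 ?_
    rintro _ ⟨γ, hγ, rfl⟩
    let β : Fin n → ℕ := fun i => if p ^ e ≤ γ i then 1 else 0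
    have hβ : β ∈ hitExps α 1 := fun j => by
      obtain ⟨i, hi, h⟩ := hγ j
      exact ⟨i, hi, by simp [β, h]⟩
    have hsplit : γ = (fun i => γ i - β i * p ^ e) + fun i => β i * p ^ e := by
      ext i
      by_cases h : p ^ e ≤ γ i <;> simp [β, h]
    rw [hsplit, ← mon_mul_mon, ← mon_pow]
    exact Ideal.mul_mem_left _ _
      (Ideal.subset_span ⟨_, Ideal.subset_span ⟨β, hβ, rfl⟩, rfl⟩)

theorem colon_span_mon_hitExps {α : Fin r → Fin n → ℕ} (q : ℕ)
    (hinc : ∀ j l, j ≠ l → ¬ ({i | α j i = 1} ⊆ {i | α l i = 1})) :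
    (Ideal.span (mon k '' hitExps α q)).colon (Ideal.span (mon k '' hitExps α 1)) =
      Ideal.span (mon k '' colonExps α q) := by
  ext f
  rw [Submodule.mem_colon, mem_span_mon_iff_of_isUpperSet (isUpperSet_colonExps α q)]
  constructor
  · intro h d hd
    refine mem_colonExps_of_forall_add_mem hinc fun β hβ => ?_
    have := h (mon k β) (Ideal.subset_span ⟨β, hβ, rfl⟩)
    rw [smul_eq_mul, mem_span_mon_iff_of_isUpperSet (isUpperSet_hitExps α q)] at this
    exact this (d + Finsupp.equivFunOnFinite.symm β) (by rwa [coeff_add_mul_mon])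
  · classical
    intro h g hg
    have hg := (mem_span_mon_iff_of_isUpperSet (isUpperSet_hitExps α 1) g).1 hg
    rw [smul_eq_mul, mem_span_mon_iff_of_isUpperSet (isUpperSet_hitExps α q)]
    intro d hd
    rw [MvPowerSeries.coeff_mul] at hd
    obtain ⟨⟨u, v⟩, huv, hne⟩ := Finset.exists_ne_zero_of_sum_ne_zero hd
    rw [← Finset.HasAntidiagonal.mem_antidiagonal.1 huv]
    exact add_mem_hitExps (h u (left_ne_zero_of_mul hne)) (hg v (right_ne_zero_of_mul hne))

theorem span_mon_one_pow (m : ℕ) :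
    Ideal.span {mon k (fun _ : Fin n => 1) ^ m} =
      Ideal.span (mon k '' Set.Ici (fun _ => m)) := by
  ext f
  rw [mem_span_mon_iff_of_isUpperSet (isUpperSet_Ici _), mon_pow, ← Set.image_singleton,
    mem_span_mon_iff]
  simp

end FaceIdeals

/-- A monomial ideal differs from a smaller monomial ideal exactly when some minimal monomial
generator is missing from the latter. -/
theorem span_mon_ne_iff_exists_minimal {k : Type*} [Field k] {n : ℕ} {T U : Set (Fin n → ℕ)}
    (hT : IsUpperSet T) (hU : IsUpperSet U) (hUT : U ⊆ T) :
    Ideal.span (mon k '' T) ≠ Ideal.span (mon k '' U) ↔ ∃ γ, Minimal (· ∈ T) γ ∧ γ ∉ U := by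
  constructor
  · intro hne
    by_contra! h
    refine hne (congrArg _ (congrArg _ (Set.Subset.antisymm (fun γ hγ => ?_) hUT)))
    obtain ⟨δ, hδγ, hδ⟩ := exists_minimal_le_of_wellFoundedLT (· ∈ T) γ hγ
    exact hU hδγ (h δ hδ)
  · rintro ⟨γ, hγ, hγU⟩ heq
    rw [← mon_mem_span_mon_iff (k := k) hU, ← heq, mon_mem_span_mon_iff hT] at hγU
    exact hγU hγ.1

theorem statement6 (p : ℕ) [Fact p.Prime] (k : Type*) [Field k] [CharP k p]
    (n : ℕ) (hn : 0 < n) (r : ℕ) (hr : 0 < r) (α : Fin r → Fin n → ℕ)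
    (I : Ideal (MvPowerSeries (Fin n) k)) (hdec : IsMinFaceDecomp k α I)
    (hsum : (⨆ j, faceIdeal k (α j)) =
      Ideal.span (Set.range (MvPowerSeries.X : Fin n → MvPowerSeries (Fin n) k)))
    (e : ℕ) :
    (Jideal k (p ^ e) I ≠ ⊥ ↔
      (frobPow (p ^ e) I).colon I ≠
        frobPow (p ^ e) I ⊔ Ideal.span {mon k (fun _ => 1) ^ (p ^ e - 1)}) ∧
    (Jideal k (p ^ e) I ≠ ⊥ ↔
      ∃ γ : Fin n → ℕ, IsMinGen k ((frobPow (p ^ e) I).colon I) γ ∧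
        (∃ i, γ i = p ^ e) ∧ (∃ j, γ j = p ^ e - 1) ∧ (∃ l, γ l = 0)) := by
  obtain ⟨h01, hnz, rfl, hinc⟩ := hdec
  set q := p ^ e with hq
  have hq1 : 1 ≤ q := Nat.one_le_pow _ _ (Fact.out : p.Prime).pos
  have hne : ∀ j, ∃ i, α j i = 1 := fun j => by
    obtain ⟨i, hi⟩ := Function.ne_iff.1 (hnz j)
    exact ⟨i, (h01 j i).resolve_left hi⟩
  have hcov := exists_eq_one_of_iSup_faceIdeal α hsum
  have hfrob : frobPow q (⨅ j, faceIdeal k (α j)) = Ideal.span (mon k '' hitExps α q) := by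
    rw [iInf_faceIdeal_eq_span_mon, hq, frobPow_span_mon_hitExps]
  have hcolon : (frobPow q (⨅ j, faceIdeal k (α j))).colon (⨅ j, faceIdeal k (α j) : Ideal _) =
      Ideal.span (mon k '' colonExps α q) := by
    rw [hfrob, iInf_faceIdeal_eq_span_mon, colon_span_mon_hitExps q hinc]
  have hJ : Jideal k q (⨅ j, faceIdeal k (α j)) ≠ ⊥ ↔ ∃ γ, Minimal (· ∈ colonExps α q) γ ∧
      γ ∉ hitExps α q ∧ γ ∉ Set.Ici (fun _ => q - 1) := by
    rw [Jideal, Ne, Ideal.span_eq_bot, hcolon, hfrob, span_mon_one_pow]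
    simp [mon_ne_zero, isMinGen_span_mon_iff (isUpperSet_colonExps α q),
      mon_mem_span_mon_iff (isUpperSet_hitExps α q), mon_mem_span_mon_iff (isUpperSet_Ici _)]
  constructor
  · rw [hJ, hcolon, hfrob, span_mon_one_pow, ← Ideal.span_union, ← Set.image_union,
      span_mon_ne_iff_exists_minimal (isUpperSet_colonExps α q)
        ((isUpperSet_hitExps α q).union (isUpperSet_Ici _))
        (Set.union_subset (hitExps_subset_colonExps α q) (Ici_subset_colonExps α q))]
    simp only [Set.mem_union, not_or]
  · rw [hJ, hcolon]
    refine exists_congr fun γ => ?_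
    rw [isMinGen_span_mon_iff (isUpperSet_colonExps α q)]
    exact and_congr_right fun hγ => minimal_colonExps_iff hq1 hne hcov hγ

end
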